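/- arXiv:2305.17222 — 12 statements merged into one kernel-verified Lean document; each statement's English description precedes it below -/
import Mathlib

section
/- Let n ≥ 2. Consider n users, capacity C = n, and n+1 quanta, where each of users 1, …, n−1 demands 1 in every quantum, and user n demands 0 in quanta 1, …, n and demands n in quantum n+1. Then under the repeated per-quantum max-min fair allocation, each of users 1, …, n−1 receives cumulative allocation n+1 over the n+1 quanta, while user n receives cumulative allocation 1; hence the ratio of the maximum over the minimum cumulative allocation across users equals n+1. -/
open Finset

/-- One quantum of per-quantum max-min fair allocation: `n` users share a single
divisible resource of capacity `C` per quantum; given nonnegative demands `d`,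
user `k` receives `m k = min (d k) lam`, where `lam ≥ 0` is chosen so that
`∑ k, m k = min C (∑ k, d k)`. -/
def MaxMinStep (n : ℕ) (C : ℝ) (d m : Fin n → ℝ) : Prop :=
  ∃ lam : ℝ, 0 ≤ lam ∧ (∀ k, m k = min (d k) lam) ∧
    (∑ k, m k) = min C (∑ k, d k)

/-- Max-min fair allocations are unique: any two allocations of the same capacity to the same
demands agree. -/
theorem MaxMinStep.unique {n : ℕ} {C : ℝ} {d m m' : Fin n → ℝ}
    (h : MaxMinStep n C d m) (h' : MaxMinStep n C d m') : m = m' := by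
  obtain ⟨l, -, hl, hs⟩ := h
  obtain ⟨l', -, hl', hs'⟩ := h'
  have key : ∀ {a b : ℝ} {u v : Fin n → ℝ}, a ≤ b → (∀ k, u k = min (d k) a) →
      (∀ k, v k = min (d k) b) → ∑ k, u k = ∑ k, v k → u = v := by
    intro a b u v hab hu hv huv
    have hle : ∀ k ∈ Finset.univ, u k ≤ v k := fun k _ => by
      rw [hu, hv]
      exact min_le_min_left _ hab
    funext k
    exact (Finset.sum_eq_sum_iff_of_le hle).1 huv k (Finset.mem_univ k)
  rcases le_total l l' with hll | hll
  · exact key hll hl hl' (hs.trans hs'.symm)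
  · exact (key hll hl' hl (hs'.trans hs.symm)).symm

/-- If no user demands more than an equal share of one unit, all demands are met. -/
theorem MaxMinStep.eq_demand {n : ℕ} {d m : Fin n → ℝ} (h : MaxMinStep n n d m)
    (hd : ∀ k, d k ≤ 1) : m = d := by
  refine h.unique ⟨1, zero_le_one, fun k => (min_eq_left (hd k)).symm, ?_⟩
  refine (min_eq_right ?_).symm
  simpa using Finset.sum_le_sum fun k (_ : k ∈ Finset.univ) => hd k

/-- If every user demands at least an equal share of one unit, every user gets one unit. -/
theorem MaxMinStep.eq_one {n : ℕ} {d m : Fin n → ℝ} (h : MaxMinStep n n d m)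
    (hd : ∀ k, 1 ≤ d k) : m = fun _ => 1 := by
  refine h.unique ⟨1, zero_le_one, fun k => (min_eq_right (hd k)).symm, ?_⟩
  have hsum : (n : ℝ) ≤ ∑ k, d k := by
    simpa using Finset.sum_le_sum fun k (_ : k ∈ Finset.univ) => hd k
  simp [min_eq_left hsum]

/-- With `n ≥ 2` users, capacity `C = n` and `n + 1` quanta (0-based,
`t = 0, …, n`), where each of the first `n - 1` users demands `1` in every
quantum and the last user demands `0` in the first `n` quanta and `n` in the
last quantum, repeated per-quantum max-min fairness gives each of the first
`n - 1` users a cumulative allocation of `n + 1` and the last user a cumulative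
allocation of `1`; hence the ratio of the maximum over the minimum cumulative
allocation across users equals `n + 1`. -/
theorem maxmin_unfair_for_dynamic_demands (n : ℕ) (hn : 2 ≤ n)
    (d m : ℕ → Fin n → ℝ)
    (hd : ∀ t, ∀ k : Fin n, d t k =
      if (k : ℕ) = n - 1 then (if t = n then (n : ℝ) else 0) else 1)
    (hm : ∀ t, t < n + 1 → MaxMinStep n (n : ℝ) (d t) (m t)) :
    (∀ k : Fin n, (k : ℕ) ≠ n - 1 →
      (∑ t ∈ Finset.range (n + 1), m t k) = (n : ℝ) + 1) ∧
    (∀ k : Fin n, (k : ℕ) = n - 1 →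
      (∑ t ∈ Finset.range (n + 1), m t k) = 1) ∧
    (Finset.univ.sup' (Finset.univ_nonempty_iff.mpr ⟨⟨0, by omega⟩⟩)
        (fun k : Fin n => ∑ t ∈ Finset.range (n + 1), m t k)) /
      (Finset.univ.inf' (Finset.univ_nonempty_iff.mpr ⟨⟨0, by omega⟩⟩)
        (fun k : Fin n => ∑ t ∈ Finset.range (n + 1), m t k)) = (n : ℝ) + 1 := by
  have hn1 : (1 : ℝ) ≤ n := by exact_mod_cast (by omega : 1 ≤ n)
  have early : ∀ t < n, m t = d t := fun t ht =>
    (hm t (by omega)).eq_demand fun k => by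
      rw [hd, if_neg ht.ne]
      split_ifs <;> norm_num
  have last : m n = fun _ => 1 := (hm n (by omega)).eq_one fun k => by
    rw [hd, if_pos rfl]
    split_ifs
    exacts [hn1, le_rfl]
  have total : ∀ k : Fin n, ∑ t ∈ Finset.range (n + 1), m t k =
      if (k : ℕ) = n - 1 then 1 else (n : ℝ) + 1 := by
    intro k
    have hsum : ∑ t ∈ Finset.range n, m t k =
        ∑ t ∈ Finset.range n, if (k : ℕ) = n - 1 then (0 : ℝ) else 1 := by
      refine Finset.sum_congr rfl fun t ht => ?_
      have ht := Finset.mem_range.1 ht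
      rw [early t ht, hd, if_neg ht.ne]
    rw [Finset.sum_range_succ, hsum, last]
    split_ifs <;> simp
  refine ⟨fun k hk => by rw [total, if_neg hk], fun k hk => by rw [total, if_pos hk], ?_⟩
  simp only [total]
  have hsup : (Finset.univ.sup' (Finset.univ_nonempty_iff.mpr ⟨⟨0, by omega⟩⟩)
      fun k : Fin n => if (k : ℕ) = n - 1 then (1 : ℝ) else n + 1) = n + 1 := by
    apply le_antisymm
    · refine Finset.sup'_le _ _ fun k _ => ?_
      split_ifs <;> linarith
    · refine Finset.le_sup'_of_le _ (Finset.mem_univ (⟨0, by omega⟩ : Fin n)) ?_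
      rw [if_neg (show ¬ 0 = n - 1 by omega)]
  have hinf : (Finset.univ.inf' (Finset.univ_nonempty_iff.mpr ⟨⟨0, by omega⟩⟩)
      fun k : Fin n => if (k : ℕ) = n - 1 then (1 : ℝ) else n + 1) = 1 := by
    apply le_antisymm
    · refine Finset.inf'_le_of_le _ (Finset.mem_univ (⟨n - 1, by omega⟩ : Fin n)) ?_
      rw [if_pos rfl]
    · refine Finset.le_inf' _ _ fun k _ => ?_
      split_ifs <;> linarith
  rw [hsup, hinf, div_one]
end

section
/- Let n ≥ 1, C ≥ 0, and let R_k ≥ 0 and d_k ≥ 0 for k = 1, …, n be real numbers. Then there exists λ ≥ 0 such that the allocation r_k = min(d_k, (λ − R_k)⁺) satisfies Σ_k r_k = min(C, Σ_k d_k). Consequently 0 ≤ r_k ≤ d_k for every k, and the allocation r is Pareto efficient: there is no allocation r' with 0 ≤ r'_k ≤ d_k for all k and Σ_k r'_k ≤ C such that r'_k ≥ r_k for all k and r'_j > r_j for some j. -/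
open Finset

/-- One step of the Karma algorithm with instantaneous guarantee `α = 0`
(assuming no user runs out of credits): from prior cumulative allocations `R`
and reported demands `d`, each user `k` is allocated
`r k = min (d k) ((lam - R k)⁺)`, where the water level `lam ≥ 0` is such that
`∑ k, r k = min C (∑ k, d k)`. -/
def KarmaStep (n : ℕ) (C : ℝ) (R d r : Fin n → ℝ) : Prop :=
  ∃ lam : ℝ, 0 ≤ lam ∧ (∀ k, r k = min (d k) (max (lam - R k) 0)) ∧
    (∑ k, r k) = min C (∑ k, d k)

/-- Cumulative allocation of user `k` before quantum `t` (quanta are 0-based):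
`cum n r t k = ∑_{τ < t} r τ k`. -/
def cum (n : ℕ) (r : ℕ → Fin n → ℝ) (t : ℕ) (k : Fin n) : ℝ :=
  ∑ τ ∈ Finset.range t, r τ k

/-- A run of the Karma algorithm over quanta `0, 1, 2, …` with reported
demands `d t` and allocations `r t`, starting from zero cumulative
allocations. -/
def KarmaRun (n : ℕ) (C : ℝ) (d r : ℕ → Fin n → ℝ) : Prop :=
  ∀ t, KarmaStep n C (cum n r t) (d t) (r t)

/-- The water level can be tuned so that the total allocation is any target between zero and
the total demand. -/
theorem exists_water_level {ι : Type*} [Fintype ι] (R d : ι → ℝ) (hR : ∀ k, 0 ≤ R k)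
    (hd : ∀ k, 0 ≤ d k) {S : ℝ} (hS : 0 ≤ S) (hSd : S ≤ ∑ k, d k) :
    ∃ lam : ℝ, 0 ≤ lam ∧ ∑ k, min (d k) (max (lam - R k) 0) = S := by
  have hL : 0 ≤ ∑ k, (R k + d k) := Finset.sum_nonneg fun k _ => add_nonneg (hR k) (hd k)
  have hcont : Continuous fun lam : ℝ => ∑ k, min (d k) (max (lam - R k) 0) := by fun_prop
  have hzero : ∑ k, min (d k) (max (0 - R k) 0) = 0 :=
    Finset.sum_eq_zero fun k _ => by
      rw [max_eq_right (by linarith [hR k]), min_eq_right (hd k)]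
  have htop : ∑ k, min (d k) (max ((∑ i, (R i + d i)) - R k) 0) = ∑ k, d k :=
    Finset.sum_congr rfl fun k _ => by
      have hk : R k + d k ≤ ∑ i, (R i + d i) :=
        Finset.single_le_sum (f := fun i => R i + d i)
          (fun i _ => add_nonneg (hR i) (hd i)) (Finset.mem_univ k)
      exact min_eq_left (le_max_of_le_left (by linarith))
  obtain ⟨lam, hlam, h⟩ := intermediate_value_Icc hL hcont.continuousOn
    (show S ∈ Set.Icc _ _ from ⟨hzero.trans_le hS, hSd.trans_eq htop.symm⟩)
  exact ⟨lam, hlam.1, h⟩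

/-- For `n ≥ 1` users, capacity `C ≥ 0`, nonnegative prior cumulative
allocations `R` and nonnegative demands `d`, there is a water level `lam ≥ 0`
such that the Karma step allocation `r k = min (d k) ((lam - R k)⁺)` satisfies
`∑ k, r k = min C (∑ k, d k)`; consequently `0 ≤ r k ≤ d k` for every `k`, and
`r` is Pareto efficient: there is no allocation `r'` with `0 ≤ r' k ≤ d k` for
all `k` and `∑ k, r' k ≤ C` that dominates `r` (i.e. `r k ≤ r' k` for all `k`
with strict inequality for some `j`). -/
theorem karma_step_exists_and_pareto_efficient (n : ℕ) (hn : 1 ≤ n)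
    (C : ℝ) (hC : 0 ≤ C) (R d : Fin n → ℝ)
    (hR : ∀ k, 0 ≤ R k) (hd : ∀ k, 0 ≤ d k) :
    ∃ lam : ℝ, 0 ≤ lam ∧
      (∑ k, min (d k) (max (lam - R k) 0)) = min C (∑ k, d k) ∧
      (∀ k, 0 ≤ min (d k) (max (lam - R k) 0) ∧
        min (d k) (max (lam - R k) 0) ≤ d k) ∧
      ¬ ∃ r' : Fin n → ℝ,
          (∀ k, 0 ≤ r' k ∧ r' k ≤ d k) ∧ (∑ k, r' k) ≤ C ∧
          (∀ k, min (d k) (max (lam - R k) 0) ≤ r' k) ∧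
          (∃ j, min (d j) (max (lam - R j) 0) < r' j) := by
  obtain ⟨lam, hlam, hsum⟩ := exists_water_level R d hR hd
    (le_min hC (Finset.sum_nonneg fun k _ => hd k)) (min_le_right C _)
  refine ⟨lam, hlam, hsum, fun k => ⟨le_min (hd k) (le_max_right _ _), min_le_left _ _⟩, ?_⟩
  rintro ⟨r', hr', hC', hle, j, hj⟩
  have hlt := Finset.sum_lt_sum (fun k _ => hle k) ⟨j, Finset.mem_univ j, hj⟩
  rw [hsum] at hlt
  exact hlt.not_ge (le_min hC' (Finset.sum_le_sum fun k _ => (hr' k).2))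
end

section
/- Let n ≥ 1, C > 0, and let R_k ≥ 0 and d_k ≥ 0 for k = 1, …, n be real numbers. Let r_k = min(d_k, (λ − R_k)⁺) where λ ≥ 0 satisfies Σ_k r_k = min(C, Σ_k d_k). Then r maximizes the minimum resulting cumulative allocation: for every allocation r' with 0 ≤ r'_k ≤ d_k for all k and Σ_k r'_k ≤ C, one has min_k (R_k + r'_k) ≤ min_k (R_k + r_k). -/
open Finset

/-- A Karma step maximizes the minimum resulting cumulative allocation: if `r`
is the Karma step allocation from nonnegative prior cumulative allocations `R`
and nonnegative demands `d` with capacity `C > 0`, then for every allocation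
`r'` with `0 ≤ r' k ≤ d k` for all `k` and `∑ k, r' k ≤ C`, we have
`min_k (R k + r' k) ≤ min_k (R k + r k)`. -/
theorem karma_step_maximizes_min_cumulative (n : ℕ) (hn : 0 < n)
    (C : ℝ) (hC : 0 < C) (R d r : Fin n → ℝ)
    (hR : ∀ k, 0 ≤ R k) (hd : ∀ k, 0 ≤ d k)
    (hstep : KarmaStep n C R d r)
    (r' : Fin n → ℝ) (hr' : ∀ k, 0 ≤ r' k ∧ r' k ≤ d k)
    (hsum : (∑ k, r' k) ≤ C) :
    Finset.univ.inf' (Finset.univ_nonempty_iff.mpr ⟨⟨0, hn⟩⟩)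
        (fun k => R k + r' k) ≤
      Finset.univ.inf' (Finset.univ_nonempty_iff.mpr ⟨⟨0, hn⟩⟩)
        (fun k => R k + r k) := by
  obtain ⟨lam, -, hr, hsum_r⟩ := hstep
  refine Finset.le_inf' _ _ fun k _ => ?_
  by_contra! hlt
  rw [Finset.lt_inf'_iff] at hlt
  have hk : r k < r' k := by linarith [hlt k (mem_univ k)]
  have hlam : lam ≤ R k + r k := by
    rcases min_choice (d k) (max (lam - R k) 0) with h | h
    · linarith [hr k, (hr' k).2]
    · linarith [hr k, le_max_left (lam - R k) 0]
  have hle : ∀ j ∈ univ, r j ≤ r' j := fun j hj => by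
    rw [hr j]
    exact (min_le_right _ _).trans (max_le (by linarith [hlt j hj]) (hr' j).1)
  have hsum_lt : ∑ j, r j < ∑ j, r' j := Finset.sum_lt_sum hle ⟨k, mem_univ k, hk⟩
  have hsum_le : ∑ j, r' j ≤ min C (∑ j, d j) :=
    le_min hsum (Finset.sum_le_sum fun j _ => (hr' j).2)
  linarith
end

section
/- Fix a quantum t and two states: nonnegative prior cumulative allocations (R_k^{t−1})_k and (R̂_k^{t−1})_k and nonnegative demands (d_k^t)_k and (d̂_k^t)_k. Let r^t and r̂^t be the Karma step allocations from these respective states, and set R_k^t = R_k^{t−1} + r_k^t and R̂_k^t = R̂_k^{t−1} + r̂_k^t. Suppose i ≠ j are two users such that: r_i^t < r̂_i^t and r_i^t < d_i^t, and r_j^t > r̂_j^t and r̂_j^t < d̂_j^t. Then R_i^t ≥ R_j^t and R̂_i^t ≤ R̂_j^t; in particular R̂_i^t − R_i^t ≤ R̂_j^t − R_j^t. -/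
open Finset

/-- (Lemma `more_less`.) Fix one quantum and two states: nonnegative prior
cumulative allocations `R`, `Rh` and nonnegative demands `d`, `dh`, with Karma
step allocations `r` and `rh` respectively. If users `i ≠ j` satisfy
`r i < rh i`, `r i < d i`, `rh j < r j` and `rh j < dh j`, then
`R i + r i ≥ R j + r j` and `Rh i + rh i ≤ Rh j + rh j`; in particular
`(Rh i + rh i) - (R i + r i) ≤ (Rh j + rh j) - (R j + r j)`. -/
theorem karma_more_less (n : ℕ) (C : ℝ) (hC : 0 < C)
    (R Rh d dh r rh : Fin n → ℝ)
    (hR : ∀ k, 0 ≤ R k) (hRh : ∀ k, 0 ≤ Rh k)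
    (hd : ∀ k, 0 ≤ d k) (hdh : ∀ k, 0 ≤ dh k)
    (hstep : KarmaStep n C R d r) (hsteph : KarmaStep n C Rh dh rh)
    (i j : Fin n) (hij : i ≠ j)
    (h1 : r i < rh i) (h2 : r i < d i)
    (h3 : rh j < r j) (h4 : rh j < dh j) :
    R j + r j ≤ R i + r i ∧ Rh i + rh i ≤ Rh j + rh j ∧
    (Rh i + rh i) - (R i + r i) ≤ (Rh j + rh j) - (R j + r j) := by
  obtain ⟨lam, -, hr, -⟩ := hstep
  obtain ⟨lamh, -, hrh, -⟩ := hsteph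
  have level_le {a D x l : ℝ} (hx : x = min D (max (l - a) 0)) (hlt : x < D) : l ≤ a + x := by
    grind
  have le_level {a D x l : ℝ} (hx : x = min D (max (l - a) 0)) (hpos : 0 < x) : a + x ≤ l := by
    grind
  have hri : 0 ≤ r i := hr i ▸ le_min (hd i) (le_max_right _ _)
  have hrhj : 0 ≤ rh j := hrh j ▸ le_min (hdh j) (le_max_right _ _)
  have hi := level_le (hr i) h2
  have hj := le_level (hr j) (hrhj.trans_lt h3)
  have hhi := le_level (hrh i) (hri.trans_lt h1)
  have hhj := level_le (hrh j) h4
  refine ⟨?_, ?_, ?_⟩ <;> linarith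
end

section
/- Fix a quantum t and nonnegative prior cumulative allocations (R_k^{t−1})_k and (R̂_k^{t−1})_k. Let (d_k^t)_k be nonnegative demands and let (d̂_k^t)_k satisfy d̂_k^t = d_k^t for all k ≠ 1 and d̂_1^t ≤ d_1^t. Let r^t and r̂^t be the Karma step allocations from the respective states, and set R_k^t = R_k^{t−1} + r_k^t and R̂_k^t = R̂_k^{t−1} + r̂_k^t. Then Σ_k (R̂_k^t − R_k^t)⁺ − Σ_k (R̂_k^{t−1} − R_k^{t−1})⁺ ≤ r_1^t · 𝟙[d̂_1^t < d_1^t]; in particular, if d̂_1^t = d_1^t the left-hand side is at most 0. -/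
open Finset

/-- Moving to a lower water level and a smaller demand does not increase the excess of one
cumulative allocation over another. -/
theorem overalloc_le_of_level_le {a b d e l m : ℝ} (hml : m ≤ l) (hed : e ≤ d) :
    max ((b + min e (max (m - b) 0)) - (a + min d (max (l - a) 0))) 0 ≤ max (b - a) 0 := by
  grind

/-- The total allocation of a Karma step is monotone in the demands. -/
theorem KarmaStep.sum_le_sum {n : ℕ} {C : ℝ} {R Rh d dh r rh : Fin n → ℝ}
    (hstep : KarmaStep n C R d r) (hsteph : KarmaStep n C Rh dh rh) (h : ∀ k, dh k ≤ d k) :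
    ∑ k, rh k ≤ ∑ k, r k := by
  obtain ⟨_, _, _, hs⟩ := hstep
  obtain ⟨_, _, _, hsh⟩ := hsteph
  rw [hs, hsh]
  exact min_le_min_left C (Finset.sum_le_sum fun k _ => h k)

/-- (One-step bound on the total over-allocation.) Fix a quantum with
nonnegative prior cumulative allocations `R`, `Rh` and nonnegative demands
`d`, `dh`, where `dh` agrees with `d` except that the deviating user `u` does
not over-report (`dh u ≤ d u`). If `r`, `rh` are the respective Karma step
allocations, then the increase of the total over-allocation
`∑ k ((Rh k + rh k) - (R k + r k))⁺ - ∑ k (Rh k - R k)⁺` is at most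
`r u · 𝟙[dh u < d u]`; in particular, if `dh u = d u` it is at most `0`. -/
theorem karma_overalloc_step_bound (n : ℕ) (C : ℝ) (hC : 0 < C) (u : Fin n)
    (R Rh d dh r rh : Fin n → ℝ)
    (hR : ∀ k, 0 ≤ R k) (hRh : ∀ k, 0 ≤ Rh k)
    (hd : ∀ k, 0 ≤ d k) (hdh : ∀ k, 0 ≤ dh k)
    (hsame : ∀ k, k ≠ u → dh k = d k) (hunder : dh u ≤ d u)
    (hstep : KarmaStep n C R d r) (hsteph : KarmaStep n C Rh dh rh) :
    ((∑ k, max ((Rh k + rh k) - (R k + r k)) 0) -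
        (∑ k, max (Rh k - R k) 0) ≤ if dh u < d u then r u else 0) ∧
    (dh u = d u →
      (∑ k, max ((Rh k + rh k) - (R k + r k)) 0) -
        (∑ k, max (Rh k - R k) 0) ≤ 0) := by
  have hle : ∀ k, dh k ≤ d k := fun k => by
    by_cases hk : k = u
    · exact hk ▸ hunder
    · exact (hsame k hk).le
  suffices h : (∑ k, max ((Rh k + rh k) - (R k + r k)) 0) -
      (∑ k, max (Rh k - R k) 0) ≤ if dh u < d u then r u else 0 from
    ⟨h, fun heq => by simpa [heq] using h⟩
  have hsum := hstep.sum_le_sum hsteph hle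
  obtain ⟨l, -, hr, -⟩ := hstep
  obtain ⟨m, -, hrh, -⟩ := hsteph
  have hr0 : 0 ≤ r u := by
    rw [hr]; exact le_min (hd u) (le_max_right _ _)
  have hrh0 : 0 ≤ rh u := by
    rw [hrh]; exact le_min (hdh u) (le_max_right _ _)
  rcases le_total m l with hml | hlm
  · have hterm : (∑ k, max ((Rh k + rh k) - (R k + r k)) 0) ≤ ∑ k, max (Rh k - R k) 0 :=
      Finset.sum_le_sum fun k _ => by
        rw [hr, hrh]; exact overalloc_le_of_level_le hml (hle k)
    split_ifs <;> linarith
  · have hterm : ∀ k, max ((Rh k + rh k) - (R k + r k)) 0 - max (Rh k - R k) 0 ≤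
        (rh k - r k) + if k = u then (if dh u < d u then r u else 0) else 0 := fun k => by
      by_cases hlt : k = u ∧ dh u < d u
      · obtain ⟨rfl, hlt⟩ := hlt
        rw [if_pos rfl, if_pos hlt]
        grind
      · have hdk : d k ≤ dh k := by
          by_cases hk : k = u
          · subst hk; exact not_lt.mp fun h => hlt ⟨rfl, h⟩
          · exact (hsame k hk).ge
        have h := overalloc_le_of_level_le (a := Rh k) (b := R k) hlm hdk
        rw [← hr, ← hrh] at h
        grind
    have htotal := Finset.sum_le_sum fun k (_ : k ∈ Finset.univ) => hterm k
    simp only [Finset.sum_add_distrib, Finset.sum_sub_distrib, Finset.sum_ite_eq',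
      Finset.mem_univ, if_true] at htotal
    linarith
end

section
/- Suppose every user k ≠ 1 reports truthfully (d̂_k^t = d_k^t for all t) and user 1 never over-reports (d̂_1^t ≤ d_1^t for all t). Let (r_k^t, R_k^t) and (r̂_k^t, R̂_k^t) be the Karma allocations under the true and the deviating demands respectively, both starting from R_k^0 = R̂_k^0 = 0. Then for every horizon T, Σ_k (R̂_k^T − R_k^T)⁺ ≤ Σ_{t ≤ T : d̂_1^t < d_1^t} r_1^t ≤ R_1^T; that is, the total over-allocation across all users caused by user 1's under-reporting is at most user 1's total truthful allocation. -/
open Finset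

/-- After a step, the positive part of the excess of one coordinate over another does not grow if
the first has the smaller demand and the lower water level. -/
lemma max_add_min_sub_le {a b x y l m : ℝ} (hx : 0 ≤ x) (hxy : x ≤ y) (hlm : l ≤ m) :
    max ((a + min x (max (l - a) 0)) - (b + min y (max (m - b) 0))) 0 ≤ max (a - b) 0 := by
  grind

lemma KarmaStep.nonneg {n : ℕ} {C : ℝ} {R d r : Fin n → ℝ} (h : KarmaStep n C R d r)
    (hd : ∀ k, 0 ≤ d k) (k : Fin n) : 0 ≤ r k := by
  obtain ⟨lam, -, hr, -⟩ := h
  rw [hr k]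
  exact le_min (hd k) (le_max_right _ _)

/-- In one Karma step, the total over-allocation of a deviating run relative to the truthful one
grows by at most the truthful allocation of the deviating user, and only if that user
under-reports. -/
lemma KarmaStep.sum_max_sub_le {n : ℕ} {C : ℝ} {u : Fin n} {R Rh d dh r rh : Fin n → ℝ}
    (hd : ∀ k, 0 ≤ d k) (hdh : ∀ k, 0 ≤ dh k) (hsame : ∀ k, k ≠ u → dh k = d k)
    (hunder : dh u ≤ d u) (h : KarmaStep n C R d r) (hh : KarmaStep n C Rh dh rh) :
    ∑ k, max ((Rh k + rh k) - (R k + r k)) 0 ≤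
      ∑ k, max (Rh k - R k) 0 + if dh u < d u then r u else 0 := by
  have hr0 := h.nonneg hd
  have hrh0 := hh.nonneg hdh
  have hle : ∀ k, dh k ≤ d k := fun k => by
    by_cases hk : k = u
    · rwa [hk]
    · exact (hsame k hk).le
  obtain ⟨l, -, hr, hsum⟩ := h
  obtain ⟨m, -, hrh, hsumh⟩ := hh
  have hg : 0 ≤ if dh u < d u then r u else 0 := by
    split_ifs
    exacts [hr0 u, le_rfl]
  rcases le_total m l with hml | hlm
  · have : ∑ k, max ((Rh k + rh k) - (R k + r k)) 0 ≤ ∑ k, max (Rh k - R k) 0 := by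
      refine Finset.sum_le_sum fun k _ => ?_
      rw [hr k, hrh k]
      exact max_add_min_sub_le (hdh k) (hle k) hml
    linarith
  · have hneg : ∀ k, max ((R k + r k) - (Rh k + rh k)) 0 ≤
        max (R k - Rh k) 0 + if k = u then (if dh u < d u then r u else 0) else 0 := by
      intro k
      by_cases hlt : dh k < d k
      · obtain rfl : k = u := by
          by_contra hk
          exact hlt.ne (hsame k hk)
        rw [if_pos rfl, if_pos hlt]
        have := hr0 k
        have := hrh0 k
        grind
      · have hdk : d k ≤ dh k := not_lt.1 hlt
        have hstep := max_add_min_sub_le (a := R k) (b := Rh k) (hd k) hdk hlm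
        rw [← hr k, ← hrh k] at hstep
        have : 0 ≤ if k = u then (if dh u < d u then r u else 0) else 0 := by
          split_ifs <;> first | exact hr0 u | exact le_rfl
        linarith
    have hnegsum := Finset.sum_le_sum fun k (_ : k ∈ Finset.univ) => hneg k
    rw [Finset.sum_add_distrib, Finset.sum_ite_eq' Finset.univ u, if_pos (Finset.mem_univ u)]
      at hnegsum
    have htotal : ∑ k, rh k ≤ ∑ k, r k := by
      rw [hsum, hsumh]
      exact min_le_min le_rfl (Finset.sum_le_sum fun k _ => hle k)
    have hparts : ∀ f g : Fin n → ℝ,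
        ∑ k, max (f k - g k) 0 = ∑ k, f k - ∑ k, g k + ∑ k, max (g k - f k) 0 := by
      intro f g
      rw [← Finset.sum_sub_distrib, ← Finset.sum_add_distrib]
      exact Finset.sum_congr rfl fun k _ => by grind
    rw [hparts (fun k => Rh k + rh k) (fun k => R k + r k), hparts Rh R,
      Finset.sum_add_distrib, Finset.sum_add_distrib]
    linarith

/-- If every user other than `u` reports truthfully and user `u` never
over-reports (`dh t u ≤ d t u` for all `t`), then for every horizon `T` the
total over-allocation across all users caused by `u`'s under-reporting is at
most `∑_{t < T, dh t u < d t u} r t u`, which is at most user `u`'s total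
truthful allocation `R_u^T`. Both runs start from zero cumulative
allocations. -/
theorem karma_total_overalloc_bound (n : ℕ) (C : ℝ) (hC : 0 < C) (u : Fin n)
    (d dh r rh : ℕ → Fin n → ℝ)
    (hd : ∀ t k, 0 ≤ d t k) (hdh : ∀ t k, 0 ≤ dh t k)
    (hsame : ∀ t, ∀ k, k ≠ u → dh t k = d t k)
    (hunder : ∀ t, dh t u ≤ d t u)
    (hrun : KarmaRun n C d r) (hrunh : KarmaRun n C dh rh) (T : ℕ) :
    (∑ k, max (cum n rh T k - cum n r T k) 0) ≤
      (∑ t ∈ Finset.range T, if dh t u < d t u then r t u else 0) ∧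
    (∑ t ∈ Finset.range T, if dh t u < d t u then r t u else 0) ≤
      cum n r T u := by
  refine ⟨?_, ?_⟩
  · induction T with
    | zero => simp [cum]
    | succ T ih =>
      have hstep := (hrun T).sum_max_sub_le (hd T) (hdh T) (hsame T) (hunder T) (hrunh T)
      have hcum : ∀ (s : ℕ → Fin n → ℝ) (k : Fin n), cum n s (T + 1) k = cum n s T k + s T k :=
        fun s k => Finset.sum_range_succ _ _
      simp only [hcum]
      rw [Finset.sum_range_succ]
      linarith
  · refine Finset.sum_le_sum fun t _ => ?_
    have := (hrun t).nonneg (hd t) u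
    split_ifs
    exacts [le_rfl, this]
end

section
/- Suppose every user k ≠ 1 reports truthfully (d̂_k^t = d_k^t for all t) and user 1 only over-reports: d̂_1^t ≥ d_1^t for all t, where d_1^t is user 1's true demand. Then for every horizon T, user 1's total useful allocation under the deviation is at most its total useful allocation under truthful reporting: Û_1^T ≤ U_1^T (and U_1^T = R_1^T, since truthful allocations never exceed demands). -/
open Finset

theorem KarmaStep.le_demand {n : ℕ} {C : ℝ} {R d r : Fin n → ℝ}
    (h : KarmaStep n C R d r) (k : Fin n) : r k ≤ d k := by
  obtain ⟨lam, -, hr, -⟩ := h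
  exact (hr k).le.trans (min_le_left _ _)

/-- When reported demands increase, the `ℓ¹` norm of the positive part of the difference of
cumulative allocations grows by at most the total allocation in excess of the original demands. -/
theorem KarmaStep.sum_posPart_sub_le {n : ℕ} {C : ℝ} {R d r Rh dh rh : Fin n → ℝ}
    (h : KarmaStep n C R d r) (hh : KarmaStep n C Rh dh rh)
    (hd : ∀ k, 0 ≤ d k) (hle : ∀ k, d k ≤ dh k) :
    ∑ k, max (Rh k + rh k - (R k + r k)) 0 ≤
      ∑ k, max (Rh k - R k) 0 + ∑ k, (rh k - min (rh k) (d k)) := by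
  obtain ⟨lam, -, hr, hsum⟩ := h
  obtain ⟨lamh, -, hrh, hsumh⟩ := hh
  rcases le_total lamh lam with hlam | hlam
  · rw [← Finset.sum_add_distrib]
    refine Finset.sum_le_sum fun k _ => ?_
    have h1 := hr k
    have h2 := hrh k
    have h3 := hd k
    have h4 := hle k
    clear hr hrh hd hle hsum hsumh
    grind (splits := 20)
  · have hpoint : ∀ k, max (Rh k + rh k - (R k + r k)) 0 ≤
        max (Rh k - R k) 0 + (rh k - r k) := by
      intro k
      have h1 := hr k
      have h2 := hrh k
      have h3 := hd k
      have h4 := hle k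
      clear hr hrh hd hle hsum hsumh
      grind (splits := 20)
    have hmin : ∑ k, min (rh k) (d k) ≤ ∑ k, r k := by
      rw [hsum]
      refine le_min ?_ (Finset.sum_le_sum fun k _ => min_le_right _ _)
      calc ∑ k, min (rh k) (d k) ≤ ∑ k, rh k := Finset.sum_le_sum fun k _ => min_le_left _ _
        _ ≤ C := hsumh.le.trans (min_le_left _ _)
    calc ∑ k, max (Rh k + rh k - (R k + r k)) 0
        ≤ ∑ k, (max (Rh k - R k) 0 + (rh k - r k)) := Finset.sum_le_sum fun k _ => hpoint k
      _ ≤ _ := by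
        simp only [Finset.sum_add_distrib, Finset.sum_sub_distrib]
        linarith

theorem cum_succ (n : ℕ) (r : ℕ → Fin n → ℝ) (t : ℕ) (k : Fin n) :
    cum n r (t + 1) k = cum n r t k + r t k :=
  Finset.sum_range_succ _ _

theorem KarmaRun.sum_posPart_cum_sub_le {n : ℕ} {C : ℝ} {d dh r rh : ℕ → Fin n → ℝ}
    (h : KarmaRun n C d r) (hh : KarmaRun n C dh rh)
    (hd : ∀ t k, 0 ≤ d t k) (hle : ∀ t k, d t k ≤ dh t k) (T : ℕ) :
    ∑ k, max (cum n rh T k - cum n r T k) 0 ≤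
      ∑ t ∈ Finset.range T, ∑ k, (rh t k - min (rh t k) (d t k)) := by
  induction T with
  | zero => simp [cum]
  | succ T ih =>
    simp only [Finset.sum_range_succ, cum_succ]
    have := (h T).sum_posPart_sub_le (hh T) (hd T) (hle T)
    linarith

/-- (Lemma 1: over-reporting never helps.) If every user other than `u`
reports truthfully and user `u` only over-reports (`d t u ≤ dh t u` for all
`t`), then for every horizon `T` user `u`'s total useful allocation under the
deviation is at most its total useful allocation under truthful reporting;
moreover the truthful total useful allocation equals the truthful cumulative
allocation (truthful allocations never exceed demands). -/
theorem karma_overreporting_never_helps (n : ℕ) (C : ℝ) (hC : 0 < C)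
    (u : Fin n) (d dh r rh : ℕ → Fin n → ℝ)
    (hd : ∀ t k, 0 ≤ d t k) (hdh : ∀ t k, 0 ≤ dh t k)
    (hsame : ∀ t, ∀ k, k ≠ u → dh t k = d t k)
    (hover : ∀ t, d t u ≤ dh t u)
    (hrun : KarmaRun n C d r) (hrunh : KarmaRun n C dh rh) (T : ℕ) :
    (∑ t ∈ Finset.range T, min (rh t u) (d t u)) ≤
      (∑ t ∈ Finset.range T, min (r t u) (d t u)) ∧
    (∑ t ∈ Finset.range T, min (r t u) (d t u)) = cum n r T u := by
  have hmin : ∑ t ∈ Finset.range T, min (r t u) (d t u) = cum n r T u :=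
    Finset.sum_congr rfl fun t _ => min_eq_left ((hrun t).le_demand u)
  refine ⟨?_, hmin⟩
  have hle : ∀ t k, d t k ≤ dh t k := fun t k => by
    by_cases hk : k = u
    · exact hk ▸ hover t
    · exact (hsame t k hk).ge
  have hexcess : ∀ t, ∑ k, (rh t k - min (rh t k) (d t k)) = rh t u - min (rh t u) (d t u) :=
    fun t => Finset.sum_eq_single u
      (fun k _ hk => by
        rw [min_eq_left (((hrunh t).le_demand k).trans_eq (hsame t k hk)), sub_self])
      (fun hu => absurd (Finset.mem_univ u) hu)
  have hbound := hrun.sum_posPart_cum_sub_le hrunh hd hle T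
  simp only [hexcess, Finset.sum_sub_distrib] at hbound
  have hu : max (cum n rh T u - cum n r T u) 0 ≤
      ∑ k, max (cum n rh T k - cum n r T k) 0 :=
    Finset.single_le_sum (f := fun k => max (cum n rh T k - cum n r T k) 0)
      (fun k _ => le_max_right _ _) (Finset.mem_univ u)
  have hpos := le_max_left (cum n rh T u - cum n r T u) 0
  have hcum : cum n rh T u = ∑ t ∈ Finset.range T, rh t u := rfl
  rw [hmin]
  linarith
end

section
/- Suppose every user k ≠ 1 reports truthfully (d̂_k^t = d_k^t for all t) and user 1 never over-reports (d̂_1^t ≤ d_1^t for all t), both runs starting from zero cumulative allocations. If at some quantum t user 1 receives strictly more in the deviating run than in the truthful run (r̂_1^t > r_1^t), then there exists a user j ≠ 1 whose cumulative gain from the deviation is at least as large as user 1's: R̂_1^t − R_1^t ≤ R̂_j^t − R_j^t. -/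
open Finset

/-- If every user other than `u` reports truthfully, user `u` never
over-reports, and at some quantum `t` user `u` receives strictly more in the
deviating run than in the truthful run (`r t u < rh t u`), then there exists a
user `j ≠ u` whose cumulative gain from the deviation through quantum `t`
(inclusive) is at least as large as user `u`'s:
`R̂_u^t − R_u^t ≤ R̂_j^t − R_j^t`. Both runs start from zero cumulative
allocations. -/
theorem karma_exists_bigger_gainer (n : ℕ) (C : ℝ) (hC : 0 < C)
    (u : Fin n) (d dh r rh : ℕ → Fin n → ℝ)
    (hd : ∀ t k, 0 ≤ d t k) (hdh : ∀ t k, 0 ≤ dh t k)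
    (hsame : ∀ t, ∀ k, k ≠ u → dh t k = d t k)
    (hunder : ∀ t, dh t u ≤ d t u)
    (hrun : KarmaRun n C d r) (hrunh : KarmaRun n C dh rh)
    (t : ℕ) (hgain : r t u < rh t u) :
    ∃ j : Fin n, j ≠ u ∧
      cum n rh (t + 1) u - cum n r (t + 1) u ≤
        cum n rh (t + 1) j - cum n r (t + 1) j := by
  obtain ⟨lam, -, hr, hsum⟩ := hrun t
  obtain ⟨lamh, -, hrh, hsumh⟩ := hrunh t
  have hle : ∀ k, r t k ≤ d t k := fun k => (hr k).trans_le (min_le_left _ _)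
  have hleh : ∀ k, rh t k ≤ dh t k := fun k => (hrh k).trans_le (min_le_left _ _)
  have hnn : ∀ k, 0 ≤ r t k := fun k => by
    rw [hr k]; exact le_min (hd t k) (le_max_right _ _)
  have hnnh : ∀ k, 0 ≤ rh t k := fun k => by
    rw [hrh k]; exact le_min (hdh t k) (le_max_right _ _)
  have hu : r t u < d t u := hgain.trans_le ((hleh u).trans (hunder t))
  have hlt : ∑ k, r t k < ∑ k, d t k :=
    Finset.sum_lt_sum (fun k _ => hle k) ⟨u, Finset.mem_univ u, hu⟩
  have hsum_le : ∑ k, rh t k ≤ ∑ k, r t k := by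
    have hC' : ∑ k, r t k = C := by
      rcases min_choice C (∑ k, d t k) with h | h <;> linarith
    rw [hC', hsumh]
    exact min_le_left _ _
  obtain ⟨j, hj⟩ : ∃ j, rh t j < r t j := by
    by_contra! h
    have := Finset.sum_lt_sum (fun k _ => h k) ⟨u, Finset.mem_univ u, hgain⟩
    linarith
  have hju : j ≠ u := by
    rintro rfl
    exact lt_asymm hj hgain
  refine ⟨j, hju, ?_⟩
  have level_le : ∀ {x a b : ℝ}, x = min a (max b 0) → x < a → b ≤ x := by
    intro x a b hx hxa
    rcases min_choice a (max b 0) with h | h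
    · linarith
    · linarith [le_max_left b 0]
  have le_level : ∀ {x a b : ℝ}, x = min a (max b 0) → 0 < x → x ≤ b := by
    intro x a b hx hpos
    have h := hx.trans_le (min_le_right _ _)
    rcases le_max_iff.mp h with h | h <;> linarith
  have h1 := level_le (hr u) hu
  have h2 := le_level (hrh u) ((hnn u).trans_lt hgain)
  have h3 := le_level (hr j) ((hnnh j).trans_lt hj)
  have h4 := level_le (hrh j) (by rw [hsame t j hju]; exact hj.trans_le (hle j))
  have hcum : ∀ (s : ℕ → Fin n → ℝ) k, cum n s (t + 1) k = cum n s t k + s t k :=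
    fun s k => Finset.sum_range_succ _ _
  simp only [hcum]
  linarith
end

section
/- Let n ≥ 3 users share capacity C = n over 3 quanta, with true demands: user A demands (n, n, n); user B demands (n, 0, n); user C demands (0, n, 0); every other user demands 0 in every quantum. Under truthful reporting, the Karma allocations are: A receives (n/2, n/4, 3n/8) (total 9n/8), B receives (n/2, 0, 5n/8), C receives (0, 3n/4, 0). If instead user A reports (0, n, n) while all other users report truthfully, A receives (0, n/2, 3n/4), for a total useful allocation of 5n/4. Hence A strictly increases its total useful allocation by under-reporting in the first quantum (5n/4 > 9n/8). -/
open Finset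

/-- A user with zero demand receives nothing. -/
theorem KarmaStep.eq_zero {n : ℕ} {C : ℝ} {R d r : Fin n → ℝ} (h : KarmaStep n C R d r)
    {k : Fin n} (hk : d k = 0) : r k = 0 := by
  obtain ⟨lam, -, hr, -⟩ := h
  rw [hr k, hk]
  exact min_eq_left (le_max_right _ _)

/-- A single demanding user whose demand equals the capacity receives all of it. -/
theorem KarmaStep.eq_of_single {n : ℕ} {C : ℝ} {R d r : Fin n → ℝ} (h : KarmaStep n C R d r)
    {i : Fin n} (hi : d i = C) (h0 : ∀ k, k ≠ i → d k = 0) : r i = C := by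
  have hz : ∀ k, k ≠ i → r k = 0 := fun k hk => h.eq_zero (h0 k hk)
  obtain ⟨lam, -, -, hs⟩ := h
  rwa [Fintype.sum_eq_single i hz, Fintype.sum_eq_single i h0, hi, min_self] at hs

/-- Two demanding users who both ask for the whole capacity end at equal cumulative allocations,
provided their prior cumulative allocations differ by at most the capacity. -/
theorem KarmaStep.eq_of_pair {n : ℕ} {C : ℝ} {R d r : Fin n → ℝ} (h : KarmaStep n C R d r)
    (hC : 0 < C) {i j : Fin n} (hij : i ≠ j) (hi : d i = C) (hj : d j = C)
    (h0 : ∀ k, k ≠ i ∧ k ≠ j → d k = 0) (hR : |R i - R j| ≤ C) :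
    r i = (C + R j - R i) / 2 ∧ r j = (C + R i - R j) / 2 := by
  have hz : ∀ k, k ≠ i ∧ k ≠ j → r k = 0 := fun k hk => h.eq_zero (h0 k hk)
  obtain ⟨lam, -, hr, hs⟩ := h
  rw [Fintype.sum_eq_add i j hij hz, Fintype.sum_eq_add i j hij h0, hi, hj,
    min_eq_left (by linarith)] at hs
  have hri := hr i
  have hrj := hr j
  rw [hi] at hri
  rw [hj] at hrj
  obtain ⟨h1, h2⟩ := abs_le.mp hR
  rcases min_cases C (max (lam - R i) 0) with ⟨a, a'⟩ | ⟨a, a'⟩ <;>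
  rcases min_cases C (max (lam - R j) 0) with ⟨b, b'⟩ | ⟨b, b'⟩ <;>
  rcases max_cases (lam - R i) 0 with ⟨c, c'⟩ | ⟨c, c'⟩ <;>
  rcases max_cases (lam - R j) 0 with ⟨e, e'⟩ | ⟨e, e'⟩ <;>
  constructor <;> linarith

/-- (Lemma 2, lower-bound example, gain side.) Let `n ≥ 3` users share
capacity `C = n` over `3` quanta. True demands: user `A` demands `(n, n, n)`,
user `B` demands `(n, 0, n)`, user `Cu` demands `(0, n, 0)`, every other user
demands `0`. Under truthful reporting, Karma allocates `A` the amounts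
`(n/2, n/4, 3n/8)` (total `9n/8`), `B` gets `(n/2, 0, 5n/8)` and `Cu` gets
`(0, 3n/4, 0)`. If instead `A` reports `0` in the first quantum (and truth
afterwards) while all others are truthful, `A` receives `(0, n/2, 3n/4)`, a
total useful allocation of `5n/4 > 9n/8`: `A` strictly gains by
under-reporting. -/
theorem karma_underreport_gain_example (n : ℕ) (hn : 3 ≤ n)
    (A B Cu : Fin n) (hAB : A ≠ B) (hACu : A ≠ Cu) (hBCu : B ≠ Cu)
    (d dh r rh : ℕ → Fin n → ℝ)
    (hd : ∀ t, t < 3 → ∀ k, d t k =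
      if k = A then (n : ℝ)
      else if k = B then (if t = 1 then 0 else (n : ℝ))
      else if k = Cu then (if t = 1 then (n : ℝ) else 0)
      else 0)
    (hdh : ∀ t, t < 3 → ∀ k, dh t k =
      if t = 0 ∧ k = A then 0 else d t k)
    (hrun : ∀ t, t < 3 → KarmaStep n (n : ℝ) (cum n r t) (d t) (r t))
    (hrunh : ∀ t, t < 3 → KarmaStep n (n : ℝ) (cum n rh t) (dh t) (rh t)) :
    r 0 A = n / 2 ∧ r 1 A = n / 4 ∧ r 2 A = 3 * n / 8 ∧
    r 0 B = n / 2 ∧ r 1 B = 0 ∧ r 2 B = 5 * n / 8 ∧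
    r 0 Cu = 0 ∧ r 1 Cu = 3 * n / 4 ∧ r 2 Cu = 0 ∧
    rh 0 A = 0 ∧ rh 1 A = n / 2 ∧ rh 2 A = 3 * n / 4 ∧
    (∑ t ∈ Finset.range 3, min (r t A) (d t A)) = 9 * n / 8 ∧
    (∑ t ∈ Finset.range 3, min (rh t A) (d t A)) = 5 * n / 4 ∧
    9 * (n : ℝ) / 8 < 5 * n / 4 := by
  have hn0 : (0 : ℝ) < n := by exact_mod_cast (by omega : 0 < n)
  have s0 := hrun 0 (by norm_num)
  have s1 := hrun 1 (by norm_num)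
  have s2 := hrun 2 (by norm_num)
  have u0 := hrunh 0 (by norm_num)
  have u1 := hrunh 1 (by norm_num)
  have u2 := hrunh 2 (by norm_num)
  have d0 := hd 0 (by norm_num)
  have d1 := hd 1 (by norm_num)
  have d2 := hd 2 (by norm_num)
  have e0 := hdh 0 (by norm_num)
  have e1 : dh 1 = d 1 := funext fun k => by simp [hdh 1 (by norm_num)]
  have e2 : dh 2 = d 2 := funext fun k => by simp [hdh 2 (by norm_num)]
  rw [e1] at u1
  rw [e2] at u2
  have d0A : d 0 A = n := by simp [d0]
  have d1A : d 1 A = n := by simp [d1]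
  have d2A : d 2 A = n := by simp [d2]
  have d0B : d 0 B = n := by simp [d0, hAB.symm]
  have d1B : d 1 B = 0 := by simp [d1, hAB.symm]
  have d2B : d 2 B = n := by simp [d2, hAB.symm]
  have d0C : d 0 Cu = 0 := by simp [d0, hACu.symm, hBCu.symm]
  have d1C : d 1 Cu = n := by simp [d1, hACu.symm, hBCu.symm]
  have d2C : d 2 Cu = 0 := by simp [d2, hACu.symm, hBCu.symm]
  have z0 : ∀ k, k ≠ A ∧ k ≠ B → d 0 k = 0 := fun k hk => by simp [d0, hk.1, hk.2]
  have z1 : ∀ k, k ≠ A ∧ k ≠ Cu → d 1 k = 0 := fun k hk => by simp [d1, hk.1, hk.2]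
  have z2 : ∀ k, k ≠ A ∧ k ≠ B → d 2 k = 0 := fun k hk => by simp [d2, hk.1, hk.2]
  have r0C := s0.eq_zero d0C
  have r1B := s1.eq_zero d1B
  have r2C := s2.eq_zero d2C
  obtain ⟨r0A, r0B⟩ := s0.eq_of_pair hn0 hAB d0A d0B z0 (by simp [cum])
  simp only [cum, sum_range_zero, add_zero, sub_zero] at r0A r0B
  obtain ⟨r1A, r1C⟩ := s1.eq_of_pair hn0 hACu d1A d1C z1 (by
    simp only [cum, sum_range_one, r0A, r0C]
    rw [abs_le]; constructor <;> linarith)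
  simp only [cum, sum_range_one, r0A, r0C] at r1A r1C
  obtain ⟨r2A, r2B⟩ := s2.eq_of_pair hn0 hAB d2A d2B z2 (by
    simp only [cum, sum_range_succ, sum_range_zero, r0A, r0B, r1A, r1B]
    rw [abs_le]; constructor <;> linarith)
  simp only [cum, sum_range_succ, sum_range_zero, r0A, r0B, r1A, r1B] at r2A r2B
  have q0A : rh 0 A = 0 := u0.eq_zero (by simp [e0])
  have q0C : rh 0 Cu = 0 := u0.eq_zero (by simp [e0, d0C])
  have q0B : rh 0 B = n := u0.eq_of_single (by simp [e0, hAB.symm, d0B]) fun k hk => by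
    by_cases hA : k = A
    · simp [e0, hA]
    · simp [e0, hA, z0 k ⟨hA, hk⟩]
  have q1B := u1.eq_zero d1B
  obtain ⟨q1A, -⟩ := u1.eq_of_pair hn0 hACu d1A d1C z1 (by simp [cum, q0A, q0C])
  simp only [cum, sum_range_one, q0A, q0C] at q1A
  obtain ⟨q2A, -⟩ := u2.eq_of_pair hn0 hAB d2A d2B z2 (by
    simp only [cum, sum_range_succ, sum_range_zero, q0A, q0B, q1A, q1B]
    rw [abs_le]; constructor <;> linarith)
  simp only [cum, sum_range_succ, sum_range_zero, q0A, q0B, q1A, q1B] at q2A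
  refine ⟨r0A, by linarith, by linarith, r0B, r1B, by linarith, r0C, by linarith, r2C, q0A,
    by linarith, by linarith, ?_, ?_, by linarith⟩
  · simp only [sum_range_succ, sum_range_zero, d0A, d1A, d2A]
    rw [min_eq_left (by linarith), min_eq_left (by linarith), min_eq_left (by linarith)]
    linarith
  · simp only [sum_range_succ, sum_range_zero, d0A, d1A, d2A]
    rw [min_eq_left (by linarith), min_eq_left (by linarith), min_eq_left (by linarith)]
    linarith
end

section
/- Let n ≥ 3 users share capacity C = n over 3 quanta, with true demands: user A demands (n, n, n); every other user demands (0, 1, 1). Under truthful reporting, the Karma allocation gives A the allocations (n, 1, 1), a total useful allocation of n + 2. If instead user A reports (0, n, n) while all other users report truthfully, A receives (0, 1, 1), a total useful allocation of 2. Hence by under-reporting its demand in the first quantum, user A decreases its total useful allocation by a factor of (n + 2)/2. -/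
open Finset

/-- If every user other than `A` demands nothing, then the others receive nothing and `A` receives
its demand, capped by the capacity. -/
theorem KarmaStep.of_demand_eq_zero {n : ℕ} {C : ℝ} {R d r : Fin n → ℝ} {A : Fin n}
    (h : KarmaStep n C R d r) (hd : ∀ k, k ≠ A → d k = 0) :
    r A = min C (d A) ∧ ∀ k, k ≠ A → r k = 0 := by
  obtain ⟨lam, -, hr, hsum⟩ := h
  have hothers : ∀ k, k ≠ A → r k = 0 := fun k hk => by
    rw [hr k, hd k hk, min_eq_left (le_max_right _ _)]
  refine ⟨?_, hothers⟩
  rwa [Finset.sum_eq_single A (fun k _ hk => hothers k hk) (by simp),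
    Finset.sum_eq_single A (fun k _ hk => hd k hk) (by simp)] at hsum

/-- If `A` demands the whole capacity `n`, every other user demands `1`, and nobody is ahead of `A`
in cumulative allocation, then every user receives exactly `1`. -/
theorem KarmaStep.eq_one {n : ℕ} {R d r : Fin n → ℝ} {A : Fin n}
    (h : KarmaStep n (n : ℝ) R d r) (hA : d A = n) (hd : ∀ k, k ≠ A → d k = 1)
    (hR : ∀ k, R k ≤ R A) (k : Fin n) : r k = 1 := by
  obtain ⟨lam, -, hr, hsum⟩ := h
  have card_others : ((Finset.univ.erase A).card : ℝ) = n - 1 := by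
    rw [Finset.card_erase_of_mem (Finset.mem_univ A), Finset.card_univ, Fintype.card_fin,
      Nat.cast_sub A.pos, Nat.cast_one]
  have sum_others : ∑ k ∈ Finset.univ.erase A, d k = n - 1 := by
    rw [Finset.sum_congr rfl fun k hk => hd k (Finset.ne_of_mem_erase hk)]
    simp [card_others, -Finset.card_erase_of_mem, -Finset.mem_univ]
  have n_pos : (1 : ℝ) ≤ n := by exact_mod_cast A.pos
  have total : r A + ∑ k ∈ Finset.univ.erase A, r k = n := by
    rw [Finset.add_sum_erase _ _ (Finset.mem_univ A), hsum,
      ← Finset.add_sum_erase _ d (Finset.mem_univ A), hA, sum_others]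
    exact min_eq_left (by linarith)
  have others_le : ∑ k ∈ Finset.univ.erase A, r k ≤ n - 1 :=
    sum_others ▸ Finset.sum_le_sum fun k _ => (hr k).le.trans (min_le_left _ _)
  have le_level : 1 ≤ lam - R A := by
    have hmax : 1 ≤ max (lam - R A) 0 :=
      le_trans (by linarith) ((hr A).le.trans (min_le_right _ _))
    exact (le_max_iff.mp hmax).resolve_right (by norm_num)
  have others : ∀ k, k ≠ A → r k = 1 := fun k hk => by
    rw [hr k, hd k hk]
    exact min_eq_left (le_max_of_le_left (by linarith [hR k]))
  by_cases hk : k = A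
  · have : ∑ k ∈ Finset.univ.erase A, r k = n - 1 := by
      rw [← sum_others]
      refine Finset.sum_congr rfl fun j hj => ?_
      rw [others j (Finset.ne_of_mem_erase hj), hd j (Finset.ne_of_mem_erase hj)]
    rw [hk]
    linarith
  · exact others k hk

/-- If only `A` may demand in the first quantum, and in the next two quanta `A` demands the capacity
`n` while every other user demands `1`, then `A` receives its capped demand and then `1` twice. -/
theorem karma_three_quanta {n : ℕ} {A : Fin n} {d r : ℕ → Fin n → ℝ}
    (hnonneg : 0 ≤ d 0 A) (hzero : ∀ k, k ≠ A → d 0 k = 0)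
    (hA : ∀ t, 0 < t → t < 3 → d t A = n)
    (hone : ∀ t, 0 < t → t < 3 → ∀ k, k ≠ A → d t k = 1)
    (hrun : ∀ t, t < 3 → KarmaStep n (n : ℝ) (cum n r t) (d t) (r t)) :
    r 0 A = min (n : ℝ) (d 0 A) ∧ r 1 A = 1 ∧ r 2 A = 1 := by
  obtain ⟨first, first_others⟩ := (hrun 0 (by norm_num)).of_demand_eq_zero hzero
  have first_le : ∀ k, r 0 k ≤ r 0 A := fun k => by
    by_cases hk : k = A
    · rw [hk]
    · rw [first_others k hk, first]
      exact le_min n.cast_nonneg hnonneg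
  have second : ∀ k, r 1 k = 1 :=
    (hrun 1 (by norm_num)).eq_one (hA 1 (by norm_num) (by norm_num))
      (hone 1 (by norm_num) (by norm_num)) fun k => by simpa [cum] using first_le k
  have third : ∀ k, r 2 k = 1 :=
    (hrun 2 (by norm_num)).eq_one (hA 2 (by norm_num) (by norm_num))
      (hone 2 (by norm_num) (by norm_num)) fun k => by
        simpa [cum, Finset.sum_range_succ, second] using first_le k
  exact ⟨first, second A, third A⟩

/-- (Lemma 2, lower-bound example, loss side.) Let `n ≥ 3` users share
capacity `C = n` over `3` quanta. True demands: user `A` demands `(n, n, n)`;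
every other user demands `(0, 1, 1)`. Under truthful reporting, Karma
allocates `A` the amounts `(n, 1, 1)`, a total useful allocation of `n + 2`.
If instead `A` reports `0` in the first quantum (and truth afterwards) while
all others are truthful, `A` receives `(0, 1, 1)`, a total useful allocation
of `2`: by under-reporting, `A` decreases its total useful allocation by a
factor of `(n + 2) / 2`. -/
theorem karma_underreport_loss_example (n : ℕ) (hn : 3 ≤ n)
    (A : Fin n) (d dh r rh : ℕ → Fin n → ℝ)
    (hd : ∀ t, t < 3 → ∀ k, d t k =
      if k = A then (n : ℝ) else (if t = 0 then 0 else 1))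
    (hdh : ∀ t, t < 3 → ∀ k, dh t k =
      if t = 0 ∧ k = A then 0 else d t k)
    (hrun : ∀ t, t < 3 → KarmaStep n (n : ℝ) (cum n r t) (d t) (r t))
    (hrunh : ∀ t, t < 3 → KarmaStep n (n : ℝ) (cum n rh t) (dh t) (rh t)) :
    r 0 A = n ∧ r 1 A = 1 ∧ r 2 A = 1 ∧
    rh 0 A = 0 ∧ rh 1 A = 1 ∧ rh 2 A = 1 ∧
    (∑ t ∈ Finset.range 3, min (r t A) (d t A)) = (n : ℝ) + 2 ∧
    (∑ t ∈ Finset.range 3, min (rh t A) (d t A)) = 2 ∧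
    (∑ t ∈ Finset.range 3, min (r t A) (d t A)) =
      (((n : ℝ) + 2) / 2) * (∑ t ∈ Finset.range 3, min (rh t A) (d t A)) := by
  have demand_A : ∀ t, t < 3 → d t A = n := fun t ht => by simp [hd t ht]
  have zero_others : ∀ k, k ≠ A → d 0 k = 0 := fun k hk => by simp [hd 0, hk]
  have one_others : ∀ t, 0 < t → t < 3 → ∀ k, k ≠ A → d t k = 1 := fun t h0 ht k hk => by
    simp [hd t ht, hk, h0.ne']
  have dh_zero : dh 0 A = 0 := by simp [hdh 0]
  have dh_eq : ∀ t, 0 < t → t < 3 → dh t = d t := fun t h0 ht => by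
    ext k
    simp [hdh t ht, h0.ne']
  obtain ⟨r0, r1, r2⟩ := karma_three_quanta (by simp [demand_A]) zero_others
    (fun t _ ht => demand_A t ht) one_others hrun
  obtain ⟨rh0, rh1, rh2⟩ := karma_three_quanta (d := dh) dh_zero.ge
    (fun k hk => by simp [hdh 0, hk, zero_others])
    (fun t h0 ht => by rw [dh_eq t h0 ht, demand_A t ht])
    (fun t h0 ht k hk => by rw [dh_eq t h0 ht, one_others t h0 ht k hk]) hrunh
  rw [demand_A 0 (by norm_num), min_self] at r0
  rw [dh_zero, min_eq_right n.cast_nonneg] at rh0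
  have one_le : (1 : ℝ) ≤ n := by exact_mod_cast A.pos
  have useful : ∑ t ∈ Finset.range 3, min (r t A) (d t A) = (n : ℝ) + 2 := by
    simp only [Finset.sum_range_succ, Finset.sum_range_zero, r0, r1, r2,
      demand_A 0 (by norm_num), demand_A 1 (by norm_num), demand_A 2 (by norm_num),
      min_self, min_eq_left one_le]
    ring
  have useful_h : ∑ t ∈ Finset.range 3, min (rh t A) (d t A) = 2 := by
    simp only [Finset.sum_range_succ, Finset.sum_range_zero, rh0, rh1, rh2,
      demand_A 0 (by norm_num), demand_A 1 (by norm_num), demand_A 2 (by norm_num),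
      min_eq_left n.cast_nonneg, min_eq_left one_le]
    norm_num
  refine ⟨r0, r1, r2, rh0, rh1, rh2, useful, useful_h, ?_⟩
  rw [useful, useful_h]
  ring
end

section
/- Let S be a set of colluding users. Suppose every user k ∉ S reports truthfully (d̂_k^t = d_k^t for all t), and every user i ∈ S never over-reports: d̂_i^t ≤ d_i^t for all t. Then for every horizon T, the coalition cannot increase its total useful allocation by a factor of more than 2: Σ_{i∈S} Û_i^T ≤ 2·Σ_{i∈S} U_i^T. -/
open Finset

/-- A user whose demand is reported identically in both runs does not fall further behind
when the water level of the second run is at least that of the first. -/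
theorem deficit_le_of_level_le {a a' l l' d : ℝ} (hd : 0 ≤ d) (hl : l ≤ l') :
    max (a + min d (max (l - a) 0) - (a' + min d (max (l' - a') 0))) 0 ≤ max (a - a') 0 := by
  grind

/-- A user with a smaller demand and a lower water level in the second run does not get
further ahead in it. -/
theorem surplus_le_of_level_le {a a' l l' d d' : ℝ} (hd' : 0 ≤ d') (hdd : d' ≤ d)
    (hl : l' ≤ l) :
    max (a' + min d' (max (l' - a') 0) - (a + min d (max (l - a) 0))) 0 ≤ max (a' - a) 0 := by
  grind

namespace KarmaStep

variable {n : ℕ} {C : ℝ} {R d r : Fin n → ℝ}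

theorem nonneg_s15 (h : KarmaStep n C R d r) (hd : ∀ k, 0 ≤ d k) (k : Fin n) : 0 ≤ r k := by
  obtain ⟨l, -, hr, -⟩ := h
  rw [hr k]
  exact le_min (hd k) (le_max_right _ _)

theorem le_demand_s15 (h : KarmaStep n C R d r) (k : Fin n) : r k ≤ d k := by
  obtain ⟨l, -, hr, -⟩ := h
  rw [hr k]
  exact min_le_left _ _

theorem eq_demand_of_sum_le (h : KarmaStep n C R d r) (hC : ∑ k, d k ≤ C) (k : Fin n) :
    r k = d k := by
  have hle := h.le_demand_s15
  obtain ⟨l, -, -, hs⟩ := h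
  rw [min_eq_right hC] at hs
  exact (Finset.sum_eq_sum_iff_of_le fun i _ => hle i).1 hs k (Finset.mem_univ k)

/-- In one step, the total deficit of a run in which the users of `S` under-report grows by at
most what `S` is allocated in the truthful run. -/
theorem sum_deficit_le {S : Finset (Fin n)} {R' d' r' : Fin n → ℝ}
    (h : KarmaStep n C R d r) (h' : KarmaStep n C R' d' r')
    (hd' : ∀ k, 0 ≤ d' k) (hle : ∀ k, d' k ≤ d k) (hsame : ∀ k, k ∉ S → d' k = d k) :
    ∑ k, max (R k + r k - (R' k + r' k)) 0 ≤ ∑ k, max (R k - R' k) 0 + ∑ k ∈ S, r k := by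
  have hd : ∀ k, 0 ≤ d k := fun k => (hd' k).trans (hle k)
  have hr0 := h.nonneg_s15 hd
  have hr0' := h'.nonneg_s15 hd'
  have of_outside (hout : ∀ k, k ∉ S →
      max (R k + r k - (R' k + r' k)) 0 ≤ max (R k - R' k) 0) :
      ∑ k, max (R k + r k - (R' k + r' k)) 0 ≤ ∑ k, max (R k - R' k) 0 + ∑ k ∈ S, r k := by
    have hS : ∑ k ∈ S, r k = ∑ k, if k ∈ S then r k else 0 := by simp
    rw [hS, ← Finset.sum_add_distrib]
    refine Finset.sum_le_sum fun k _ => ?_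
    by_cases hk : k ∈ S
    · have := hr0 k
      have := hr0' k
      simp only [hk, if_true]
      grind
    · simpa [hk] using hout k hk
  rcases le_total (∑ k, d' k) C with hC | hC
  · refine of_outside fun k hk => max_le_max ?_ le_rfl
    have := h.le_demand_s15 k
    have := h'.eq_demand_of_sum_le hC k
    have := hsame k hk
    linarith
  obtain ⟨l, -, hr, hs⟩ := h
  obtain ⟨l', -, hr', hs'⟩ := h'
  rcases le_total l l' with hl | hl
  · refine of_outside fun k hk => ?_
    rw [hr k, hr' k, hsame k hk]
    exact deficit_le_of_level_le (hd k) hl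
  · rw [min_eq_left hC] at hs'
    rw [min_eq_left (hC.trans (Finset.sum_le_sum fun k _ => hle k))] at hs
    have key : ∑ k, max (R k + r k - (R' k + r' k)) 0 ≤
        ∑ k, (max (R k - R' k) 0 + r k - r' k) := by
      refine Finset.sum_le_sum fun k _ => ?_
      have hsur := surplus_le_of_level_le (a := R k) (a' := R' k) (hd' k) (hle k) hl
      rw [← hr k, ← hr' k] at hsur
      grind
    rw [Finset.sum_sub_distrib, Finset.sum_add_distrib] at key
    have := Finset.sum_nonneg fun k (_ : k ∈ S) => hr0 k
    linarith

theorem sum_mono {R' d' r' : Fin n → ℝ} (h : KarmaStep n C R d r)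
    (h' : KarmaStep n C R' d' r') (hle : ∀ k, d' k ≤ d k) : ∑ k, r' k ≤ ∑ k, r k := by
  obtain ⟨-, -, -, hs⟩ := h
  obtain ⟨-, -, -, hs'⟩ := h'
  rw [hs, hs']
  exact min_le_min le_rfl (Finset.sum_le_sum fun k _ => hle k)

end KarmaStep

namespace KarmaRun

variable {n : ℕ} {C : ℝ} {S : Finset (Fin n)} {d d' r r' : ℕ → Fin n → ℝ}

/-- The total deficit of a run in which the users of `S` under-report is at most the cumulative
allocation of `S` in the truthful run. -/
theorem sum_deficit_le (h : KarmaRun n C d r) (h' : KarmaRun n C d' r')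
    (hd' : ∀ t k, 0 ≤ d' t k) (hle : ∀ t k, d' t k ≤ d t k)
    (hsame : ∀ t k, k ∉ S → d' t k = d t k) (T : ℕ) :
    ∑ k, max (cum n r T k - cum n r' T k) 0 ≤ ∑ k ∈ S, cum n r T k := by
  induction T with
  | zero => simp [cum]
  | succ t ih =>
    have hstep := (h t).sum_deficit_le (h' t) (hd' t) (hle t) (hsame t)
    simp only [cum_succ, Finset.sum_add_distrib]
    linarith

theorem sum_cum_mono (h : KarmaRun n C d r) (h' : KarmaRun n C d' r')
    (hle : ∀ t k, d' t k ≤ d t k) (T : ℕ) :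
    ∑ k, cum n r' T k ≤ ∑ k, cum n r T k := by
  induction T with
  | zero => simp [cum]
  | succ t ih =>
    have hstep := (h t).sum_mono (h' t) (hle t)
    simp only [cum_succ, Finset.sum_add_distrib]
    linarith

end KarmaRun

/-- (Coalitions, under-reporting.) Let `S` be a set of colluding users. If
every user outside `S` reports truthfully and every user in `S` never
over-reports (`dh t i ≤ d t i` for all `t` and `i ∈ S`), then for every
horizon `T` the coalition's total useful allocation under the deviation is at
most `2` times its total useful allocation under truthful reporting. Both runs
start from zero cumulative allocations. -/
theorem karma_coalition_underreport_at_most_double (n : ℕ) (C : ℝ)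
    (hC : 0 < C) (S : Finset (Fin n)) (d dh r rh : ℕ → Fin n → ℝ)
    (hd : ∀ t k, 0 ≤ d t k) (hdh : ∀ t k, 0 ≤ dh t k)
    (hsame : ∀ t, ∀ k, k ∉ S → dh t k = d t k)
    (hunder : ∀ t, ∀ i ∈ S, dh t i ≤ d t i)
    (hrun : KarmaRun n C d r) (hrunh : KarmaRun n C dh rh) (T : ℕ) :
    (∑ i ∈ S, ∑ t ∈ Finset.range T, min (rh t i) (d t i)) ≤
      2 * ∑ i ∈ S, ∑ t ∈ Finset.range T, min (r t i) (d t i) := by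
  have hle : ∀ t k, dh t k ≤ d t k := fun t k => by
    by_cases hk : k ∈ S
    · exact hunder t k hk
    · exact (hsame t k hk).le
  have huseful : ∀ t k, min (r t k) (d t k) = r t k := fun t k =>
    min_eq_left ((hrun t).le_demand_s15 k)
  have husefulh : ∀ t k, min (rh t k) (d t k) = rh t k := fun t k =>
    min_eq_left (((hrunh t).le_demand_s15 k).trans (hle t k))
  simp only [huseful, husefulh]
  change ∑ k ∈ S, cum n rh T k ≤ 2 * ∑ k ∈ S, cum n r T k
  have hdef := hrun.sum_deficit_le hrunh hdh hle hsame T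
  have hout : ∑ k ∈ Sᶜ, (cum n r T k - cum n rh T k) ≤
      ∑ k, max (cum n r T k - cum n rh T k) 0 :=
    (Finset.sum_le_sum fun k _ => le_max_left _ _).trans
      (Finset.sum_le_sum_of_subset_of_nonneg (Finset.subset_univ _)
        fun k _ _ => le_max_right _ _)
  rw [Finset.sum_sub_distrib] at hout
  have hsum := hrun.sum_cum_mono hrunh hle T
  rw [← Finset.sum_add_sum_compl S, ← Finset.sum_add_sum_compl S (cum n r T)] at hsum
  linarith
end

section
/- Within a single quantum, under-reporting can only decrease one's own allocation: fix nonnegative prior cumulative allocations (R_k)_k, nonnegative demands (d_k)_k, and demands (d̂_k)_k with d̂_k = d_k for all k ≠ 1 and d̂_1 ≤ d_1. Let r and r̂ be the Karma step allocations from the same prior state (R_k)_k under demands d and d̂ respectively. Then r̂_1 ≤ r_1. -/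
open Finset

/-- Within a single quantum, under-reporting can only decrease one's own
allocation: fix nonnegative prior cumulative allocations `R`, nonnegative
demands `d`, and demands `dh` agreeing with `d` except that `dh u ≤ d u`. If
`r` and `rh` are the Karma step allocations from the same prior state `R`
under demands `d` and `dh` respectively, then `rh u ≤ r u`. -/
theorem karma_step_underreport_decreases_own (n : ℕ) (C : ℝ) (hC : 0 < C)
    (u : Fin n) (R d dh r rh : Fin n → ℝ)
    (hR : ∀ k, 0 ≤ R k) (hd : ∀ k, 0 ≤ d k) (hdh : ∀ k, 0 ≤ dh k)
    (hsame : ∀ k, k ≠ u → dh k = d k) (hunder : dh u ≤ d u)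
    (hstep : KarmaStep n C R d r) (hsteph : KarmaStep n C R dh rh) :
    rh u ≤ r u := by
  obtain ⟨lam, -, hr, hsum⟩ := hstep
  obtain ⟨lamh, -, hrh, hsumh⟩ := hsteph
  by_contra! hlt
  have hlam : lam ≤ lamh := by
    by_contra! h
    have hmono : max (lamh - R u) 0 ≤ max (lam - R u) 0 := by gcongr
    have hle : rh u ≤ r u := by
      rw [hr, hrh]
      exact min_le_min hunder hmono
    exact hlt.not_ge hle
  have hle : ∀ k, r k ≤ rh k := fun k => by
    by_cases hk : k = u
    · exact hk ▸ hlt.le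
    · rw [hr, hrh, hsame k hk]
      gcongr
  have hsum_lt : ∑ k, r k < ∑ k, rh k :=
    sum_lt_sum (fun k _ => hle k) ⟨u, mem_univ u, hlt⟩
  have hdemand : ∑ k, dh k ≤ ∑ k, d k := sum_le_sum fun k _ => by
    by_cases hk : k = u
    · exact hk ▸ hunder
    · exact (hsame k hk).le
  rw [hsum, hsumh] at hsum_lt
  exact hsum_lt.not_ge (min_le_min_left C hdemand)
end
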